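/- Let Λ be the limit set of a CIFS on ℝ^d. Then the modified lower box dimension of Λ equals its lower box dimension: dim_LMB Λ = dim_LB Λ. -/

import Mathlib

open Set Metric Filter Topology MeasureTheory

noncomputable section

/-- Least number of open balls of radius `r` needed to cover `E`. -/
def coveringNumber {α : Type*} [PseudoMetricSpace α] (E : Set α) (r : ℝ) : ℕ :=
  sInf {n : ℕ | ∃ t : Finset α, t.card = n ∧ E ⊆ ⋃ x ∈ t, Metric.ball x r}

/-- `s_E(r) = log N_r(E) / log (1/r)`. -/
def sFun {α : Type*} [PseudoMetricSpace α] (E : Set α) (r : ℝ) : ℝ :=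
  Real.log (coveringNumber E r) / Real.log (1 / r)

/-- Lower box dimension. -/
def dimLB {α : Type*} [PseudoMetricSpace α] (E : Set α) : ℝ :=
  Filter.liminf (fun r => sFun E r) (nhdsWithin (0 : ℝ) (Set.Ioi 0))

/-- Upper box dimension. -/
def dimUB {α : Type*} [PseudoMetricSpace α] (E : Set α) : ℝ :=
  Filter.limsup (fun r => sFun E r) (nhdsWithin (0 : ℝ) (Set.Ioi 0))

/-- Upper right Dini derivative. -/
def upperDini (g : ℝ → ℝ) (x : ℝ) : ℝ :=
  Filter.limsup (fun h => (g (x + h) - g x) / h) (nhdsWithin (0 : ℝ) (Set.Ioi 0))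

/-- The class `𝒢(λ, α)`. -/
def GClass (lam alp : ℝ) : Set (ℝ → ℝ) :=
  {g | Continuous g ∧ (∀ x, g x ∈ Set.Icc lam alp) ∧
    ∀ x, upperDini g x ∈ Set.Icc (lam - g x) (alp - g x)}

/-- Asymptotic equivalence of two functions. -/
def AsympEquiv (f g : ℝ → ℝ) : Prop :=
  Filter.Tendsto (fun x => f x - g x) Filter.atTop (nhds 0)

/-- `E` has covering class `g`. -/
def HasCoveringClass {α : Type*} [PseudoMetricSpace α] (E : Set α) (g : ℝ → ℝ) : Prop :=
  AsympEquiv (fun x => sFun E (Real.exp (-Real.exp x))) g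

/-- Composition of the maps indexed by a finite word. -/
def compMaps {α : Type*} {I : Type*} (T : I → α → α) : List I → α → α
  | [] => id
  | i :: w => T i ∘ compMaps T w

/-- A conformal iterated function system on `ℝ^d` satisfying the open set condition
and the cone condition. -/
structure CIFS (d : ℕ) where
  /-- the compact seed set -/
  X : Set (EuclideanSpace ℝ (Fin d))
  /-- the countable index set -/
  I : Type
  /-- the contractions -/
  S : I → EuclideanSpace ℝ (Fin d) → EuclideanSpace ℝ (Fin d)
  hXcompact : IsCompact X
  hXconn : IsConnected X
  hXint : (interior X).Nonempty
  hIcount : Countable I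
  hInonempty : Nonempty I
  hSmaps : ∀ i, Set.MapsTo (S i) X X
  /-- the uniform contraction ratio -/
  c : ℝ
  hc0 : 0 < c
  hc1 : c < 1
  hcontr : ∀ i, ∀ x ∈ X, ∀ y ∈ X,
    (x ≠ y → 0 < dist (S i x) (S i y)) ∧ dist (S i x) (S i y) ≤ c * dist x y
  /-- the open connected set on which the maps extend conformally -/
  V : Set (EuclideanSpace ℝ (Fin d))
  hVopen : IsOpen V
  hVbdd : Bornology.IsBounded V
  hVconn : IsConnected V
  hXV : X ⊆ V
  /-- the conformal extensions -/
  T : I → EuclideanSpace ℝ (Fin d) → EuclideanSpace ℝ (Fin d)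
  hTagree : ∀ i, ∀ x ∈ X, T i x = S i x
  hTmaps : ∀ i, Set.MapsTo (T i) V V
  hTinj : ∀ i, Set.InjOn (T i) V
  /-- the Hölder exponent in `C^{1+ε}` -/
  eps : ℝ
  heps : 0 < eps
  hTdiff : ∀ i, ContDiffOn ℝ 1 (T i) V
  hTholder : ∀ i, ∃ C : ℝ, 0 < C ∧ ∀ x ∈ V, ∀ y ∈ V,
    ‖fderiv ℝ (T i) x - fderiv ℝ (T i) y‖ ≤ C * ‖x - y‖ ^ eps
  hTconf : ∀ i, ∀ x ∈ V, IsConformalMap (fderiv ℝ (T i) x)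
  /-- the bounded distortion constant -/
  K : ℝ
  hK : 1 ≤ K
  hBD : ∀ w : List I, ∀ x ∈ V, ∀ y ∈ V,
    ‖fderiv ℝ (compMaps T w) x‖ ≤ K * ‖fderiv ℝ (compMaps T w) y‖
  hOSCin : ∀ i, S i '' interior X ⊆ interior X
  hOSCdisj : ∀ i j, i ≠ j → Disjoint (S i '' interior X) (S j '' interior X)
  hCone : ∃ κ : ℝ, 0 < κ ∧ ∀ x ∈ X, ∀ r : ℝ, 0 < r → r < 1 →
    ENNReal.ofReal (κ * r ^ d) ≤ volume (Metric.ball x r ∩ interior X)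

/-- The limit set (attractor) of a CIFS. -/
def CIFS.limitSet {d : ℕ} (Φ : CIFS d) : Set (EuclideanSpace ℝ (Fin d)) :=
  ⋃ γ : ℕ → Φ.I, ⋂ n : ℕ, compMaps Φ.S (List.ofFn fun k : Fin (n + 1) => γ k) '' Φ.X

/-- The set of fixed points of the maps of a CIFS. -/
def CIFS.fixedPoints {d : ℕ} (Φ : CIFS d) : Set (EuclideanSpace ℝ (Fin d)) :=
  {x | x ∈ Φ.X ∧ ∃ i, Φ.S i x = x}

/-- `ρ(w) = sup_{x ∈ X} ‖S'_w(x)‖`. -/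
def CIFS.rho {d : ℕ} (Φ : CIFS d) (w : List Φ.I) : ℝ :=
  sSup ((fun x => ‖fderiv ℝ (compMaps Φ.T w) x‖) '' Φ.X)

/-- `Ψ(r, θ) = (1 - θ)·dim_H Λ + θ·s_F(r^θ)`. -/
def CIFS.Psi {d : ℕ} (Φ : CIFS d) (r θ : ℝ) : ℝ :=
  (1 - θ) * (dimH Φ.limitSet).toReal + θ * sFun Φ.fixedPoints (r ^ θ)

/-- `ψ(r) = max_{θ ∈ [0,1]} Ψ(r,θ)` (which equals the supremum over `θ ∈ (0,1]`,
since `Ψ(r,0)` is defined as the limit of `Ψ(r,θ)` as `θ → 0⁺`). -/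
def CIFS.psi {d : ℕ} (Φ : CIFS d) (r : ℝ) : ℝ :=
  sSup (Φ.Psi r '' Set.Ioc (0 : ℝ) 1)

/-- The interval `𝒟(h, s, t, α)`. -/
def Dset (h s t α : ℝ) : Set ℝ :=
  if t ≤ h then {h}
  else Set.Icc (max h s) (h + (t - h) * (α - h) * s / (α * t - h * s))

/-- The quantity whose limit as `θ → 1⁻` is the quasi-Assouad dimension. -/
def quasiAssouadAux {α : Type*} [PseudoMetricSpace α] (E : Set α) (θ : ℝ) : ℝ :=
  sInf {t : ℝ | 0 ≤ t ∧ ∃ C : ℝ, 0 < C ∧ ∀ x ∈ E, ∀ r R : ℝ,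
    0 < r → r ≤ R ^ (1 / θ) → R ^ (1 / θ) ≤ R → R < 1 →
    (coveringNumber (E ∩ Metric.ball x R) r : ℝ) ≤ C * (R / r) ^ t}

/-- The quasi-Assouad dimension. -/
def dimqA {α : Type*} [PseudoMetricSpace α] (E : Set α) : ℝ :=
  Filter.limsup (quasiAssouadAux E) (nhdsWithin (1 : ℝ) (Set.Iio 1))

/-- The modified lower box dimension. -/
def dimLMB {α : Type*} [PseudoMetricSpace α] (K : Set α) : ℝ :=
  sInf {s : ℝ | ∃ C : ℕ → Set α, (K ⊆ ⋃ i, C i) ∧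
    (∀ i, (C i).Nonempty ∧ Bornology.IsBounded (C i)) ∧ s = ⨆ i, dimLB (C i)}

/-- The unit cube `[0,1]^d`. -/
def unitCube (d : ℕ) : Set (EuclideanSpace ℝ (Fin d)) :=
  {x | ∀ j, x j ∈ Set.Icc (0 : ℝ) 1}

/-- The basic similarity maps in the homogeneous Moran construction. -/
def moranMap (d : ℕ) (r : ℝ) (i : Fin d → Bool)
    (x : EuclideanSpace ℝ (Fin d)) : EuclideanSpace ℝ (Fin d) :=
  (EuclideanSpace.equiv (Fin d) ℝ).symm (fun j => r * x j + (if i j then 1 - r else 0))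

/-- The `n`-th level of the homogeneous Moran construction. -/
def moranLevel (d : ℕ) : (ℕ → ℝ) → ℕ → Set (EuclideanSpace ℝ (Fin d))
  | _, 0 => unitCube d
  | r, n + 1 => ⋃ i : Fin d → Bool, moranMap d (r 1) i '' moranLevel d (fun k => r (k + 1)) n

/-- The homogeneous Moran set `M(r)`. -/
def moranSet (d : ℕ) (r : ℕ → ℝ) : Set (EuclideanSpace ℝ (Fin d)) :=
  ⋂ n, moranLevel d r (n + 1)

/-- The Gauss map `x ↦ 1/x - ⌊1/x⌋`. -/
def gaussMap (x : ℝ) : ℝ := Int.fract (1 / x)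

/-- The `n`-th partial quotient (continued fraction digit) of `x` (`n = 0` gives `b₁ = ⌊1/x⌋`). -/
def cfDigit (x : ℝ) (n : ℕ) : ℤ := ⌊1 / gaussMap^[n] x⌋

/-- The set of irrationals in `(0,1)` all of whose continued fraction digits lie in `I`. -/
def cfSet (I : Set ℕ) : Set ℝ :=
  {x | x ∈ Set.Ioo (0 : ℝ) 1 ∧ Irrational x ∧ ∀ n : ℕ, ∃ b ∈ I, cfDigit x n = (b : ℤ)}


section BoxDimension

variable {α β : Type*} [PseudoMetricSpace α] [PseudoMetricSpace β]

theorem coveringNumber_le_card {E : Set α} {r : ℝ} {t : Finset α}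
    (h : E ⊆ ⋃ x ∈ t, Metric.ball x r) : _root_.coveringNumber E r ≤ t.card :=
  Nat.sInf_le ⟨t, rfl, h⟩

theorem exists_card_eq_coveringNumber [ProperSpace α] {E : Set α}
    (hE : Bornology.IsBounded E) {r : ℝ} (hr : 0 < r) :
    ∃ t : Finset α, t.card = _root_.coveringNumber E r ∧ E ⊆ ⋃ x ∈ t, Metric.ball x r := by
  obtain ⟨t, -, ht, h⟩ := hE.isCompact_closure.finite_cover_balls hr
  refine Nat.sInf_mem (s := {n : ℕ | ∃ t : Finset α, t.card = n ∧ E ⊆ ⋃ x ∈ t, Metric.ball x r})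
    ⟨_, ht.toFinset, rfl, ?_⟩
  simpa using subset_closure.trans h

theorem coveringNumber_le_of_antilipschitzOn [ProperSpace β] {A : Set α} {B : Set β}
    (hB : Bornology.IsBounded B) {f : α → β} {a r : ℝ} (ha : 0 < a) (hr : 0 < r)
    (hf : ∀ x ∈ A, ∀ y ∈ A, a * dist x y ≤ dist (f x) (f y)) (hAB : f '' A ⊆ closure B) :
    _root_.coveringNumber A (4 / a * r) ≤ _root_.coveringNumber B r := by
  classical
  obtain ⟨t, ht, hcov⟩ := exists_card_eq_coveringNumber hB hr
  rcases A.eq_empty_or_nonempty with rfl | ⟨x₀, -⟩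
  · exact (coveringNumber_le_card (t := ∅) (by simp)).trans (by simp)
  have hg : ∀ z : β, ∃ y : α, ∀ x ∈ A, dist (f x) z < 2 * r → y ∈ A ∧ dist (f y) z < 2 * r := by
    intro z
    by_cases h : ∃ x ∈ A, dist (f x) z < 2 * r
    · obtain ⟨y, hy⟩ := h
      exact ⟨y, fun _ _ _ => hy⟩
    · exact ⟨x₀, fun x hx hxz => (h ⟨x, hx, hxz⟩).elim⟩
  choose g hg using hg
  rw [← ht]
  refine (coveringNumber_le_card (t := t.image g) fun x hx => ?_).trans Finset.card_image_le
  obtain ⟨b, hb, hxb⟩ := Metric.mem_closure_iff.1 (hAB ⟨x, hx, rfl⟩) r hr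
  obtain ⟨z, hz, hbz⟩ := mem_iUnion₂.1 (hcov hb)
  have hxz : dist (f x) z < 2 * r := by
    linarith [dist_triangle (f x) b z, Metric.mem_ball.1 hbz]
  obtain ⟨hyA, hyz⟩ := hg z x hx hxz
  refine mem_iUnion₂.2 ⟨g z, Finset.mem_image_of_mem g hz, ?_⟩
  rw [Metric.mem_ball, div_mul_eq_mul_div, lt_div_iff₀' ha]
  linarith [hf x hx _ hyA, dist_triangle_right (f x) (f (g z)) z]

theorem eventually_sFun_nonneg (E : Set α) : ∀ᶠ r in 𝓝[>] (0 : ℝ), 0 ≤ sFun E r := by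
  filter_upwards [Ioo_mem_nhdsGT (zero_lt_one (α := ℝ))] with r hr
  exact div_nonneg (Real.log_natCast_nonneg _)
    (Real.log_nonneg ((one_le_div hr.1).2 hr.2.le))

theorem dimLB_nonneg (E : Set α) : 0 ≤ dimLB E := by
  rw [dimLB, Filter.liminf_eq]
  exact Real.sSup_nonneg' ⟨0, eventually_sFun_nonneg E, le_rfl⟩

theorem tendsto_log_one_div : Tendsto (fun r : ℝ => Real.log (1 / r)) (𝓝[>] 0) atTop := by
  simp only [one_div]
  exact Real.tendsto_log_atTop.comp tendsto_inv_nhdsGT_zero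

/-- If covering `A` at scale `L * r` is no harder than covering `B` at scale `r`, then the lower
box dimension of `A` is at most that of `B`. -/
theorem dimLB_le_of_coveringNumber_le {A : Set α} {B : Set β} {L M : ℝ} (hL : 0 < L)
    (hB : ∀ᶠ r in 𝓝[>] (0 : ℝ), sFun B r ≤ M)
    (h : ∀ r : ℝ, 0 < r → _root_.coveringNumber A (L * r) ≤ _root_.coveringNumber B r) :
    dimLB A ≤ dimLB B := by
  refine le_of_forall_pos_le_add fun ε hε => ?_
  set b := dimLB B + ε / 2 with hb
  have hb0 : 0 ≤ b := by linarith [dimLB_nonneg B]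
  have hfreq : ∃ᶠ r in 𝓝[>] (0 : ℝ), sFun B r < b :=
    frequently_lt_of_liminf_lt
      (IsBoundedUnder.isCoboundedUnder_ge ⟨M, Filter.eventually_map.2 hB⟩)
      (show dimLB B < b by linarith)
  have hscale : Tendsto (fun r : ℝ => L * r) (𝓝[>] 0) (𝓝[>] 0) := by
    refine tendsto_nhdsWithin_iff.2 ⟨?_, ?_⟩
    · have : Tendsto (fun r : ℝ => L * r) (𝓝 0) (𝓝 (L * 0)) := tendsto_id.const_mul L
      rw [mul_zero] at this
      exact this.mono_left nhdsWithin_le_nhds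
    · filter_upwards [self_mem_nhdsWithin] with r hr
      exact mul_pos hL hr
  refine liminf_le_of_frequently_le (hscale.frequently ?_)
    ⟨0, Filter.eventually_map.2 (eventually_sFun_nonneg A)⟩
  have hlarge := tendsto_log_one_div.eventually_ge_atTop
    (max 1 (max (Real.log L + 1) (2 * (b + ε / 2) * Real.log L / ε)))
  refine (hfreq.and_eventually (hlarge.and self_mem_nhdsWithin)).mono ?_
  rintro r ⟨hrb, hr, hr0⟩
  have hr0 : 0 < r := hr0
  obtain ⟨h1, h2, h3⟩ : 1 ≤ Real.log (1 / r) ∧ Real.log L + 1 ≤ Real.log (1 / r) ∧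
      2 * (b + ε / 2) * Real.log L / ε ≤ Real.log (1 / r) := by
    simpa only [max_le_iff] using hr
  have hlog : Real.log (1 / (L * r)) = Real.log (1 / r) - Real.log L := by
    rw [one_div, one_div, Real.log_inv, Real.log_inv, Real.log_mul hL.ne' hr0.ne']
    ring
  have hmono : Real.log (_root_.coveringNumber A (L * r)) ≤
      Real.log (_root_.coveringNumber B r) := by
    rcases Nat.eq_zero_or_pos (_root_.coveringNumber A (L * r)) with h0 | h0
    · rw [h0]
      simpa using Real.log_natCast_nonneg _
    · exact Real.log_le_log (by exact_mod_cast h0) (by exact_mod_cast h r hr0)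
  rw [sFun, div_lt_iff₀ (by linarith)] at hrb
  rw [sFun, hlog, div_le_iff₀ (by linarith)]
  rw [div_le_iff₀ hε] at h3
  have : dimLB B + ε = b + ε / 2 := by rw [hb]; ring
  rw [this]
  nlinarith

end BoxDimension

section FiniteDimensional

variable (E : Type*) [NormedAddCommGroup E] [NormedSpace ℝ E] [FiniteDimensional ℝ E]

theorem exists_ball_subset_iUnion_ball_half :
    ∃ M : ℕ, 1 ≤ M ∧ ∀ (x : E) (r : ℝ), 0 < r →
      ∃ t : Finset E, t.card ≤ M ∧ Metric.ball x r ⊆ ⋃ y ∈ t, Metric.ball y (r / 2) := by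
  classical
  obtain ⟨s, -, hs, hcov⟩ := (isCompact_closedBall (0 : E) 1).finite_cover_balls
    (one_half_pos (α := ℝ))
  refine ⟨hs.toFinset.card + 1, by omega, fun x r hr =>
    ⟨hs.toFinset.image fun y => x + r • y, Finset.card_image_le.trans (by omega), ?_⟩⟩
  intro z hz
  have hz' : r⁻¹ • (z - x) ∈ Metric.closedBall (0 : E) 1 := by
    rw [mem_closedBall_zero_iff, norm_smul, norm_inv, Real.norm_of_nonneg hr.le,
      inv_mul_le_iff₀ hr, mul_one, ← dist_eq_norm]
    exact (Metric.mem_ball.1 hz).le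
  obtain ⟨y, hy, hzy⟩ := mem_iUnion₂.1 (hcov hz')
  refine mem_iUnion₂.2 ⟨x + r • y, Finset.mem_image_of_mem _ (hs.mem_toFinset.2 hy), ?_⟩
  have hzr : z - (x + r • y) = r • (r⁻¹ • (z - x) - y) := by
    rw [smul_sub, smul_inv_smul₀ hr.ne']
    abel
  rw [Metric.mem_ball, dist_eq_norm] at hzy ⊢
  rw [hzr, norm_smul, Real.norm_of_nonneg hr.le]
  nlinarith

theorem exists_ball_subset_iUnion_ball_pow :
    ∃ M : ℕ, 1 ≤ M ∧ ∀ (x : E) (r : ℝ), 0 < r → ∀ k : ℕ,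
      ∃ t : Finset E, t.card ≤ M ^ k ∧ Metric.ball x r ⊆ ⋃ y ∈ t, Metric.ball y (r / 2 ^ k) := by
  classical
  obtain ⟨M, hM, h⟩ := exists_ball_subset_iUnion_ball_half E
  refine ⟨M, hM, fun x r hr k => ?_⟩
  induction k with
  | zero => exact ⟨{x}, by simp, by simp⟩
  | succ k ih =>
    obtain ⟨t, ht, hcov⟩ := ih
    choose g hg hgcov using fun y : E => h y (r / 2 ^ k) (by positivity)
    refine ⟨t.biUnion g, ?_, fun z hz => ?_⟩
    · rw [pow_succ]
      exact (Finset.card_biUnion_le_card_mul _ _ _ fun y _ => hg y).trans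
        (Nat.mul_le_mul_right _ ht)
    · obtain ⟨y, hy, hzy⟩ := mem_iUnion₂.1 (hcov hz)
      obtain ⟨w, hw, hzw⟩ := mem_iUnion₂.1 (hgcov y hzy)
      refine mem_iUnion₂.2 ⟨w, Finset.mem_biUnion.2 ⟨y, hy, hw⟩, ?_⟩
      rwa [pow_succ, ← div_div]

/-- The functions `sFun A` are eventually bounded, uniformly over bounded sets `A`. -/
theorem exists_forall_eventually_sFun_le :
    ∃ M : ℝ, ∀ A : Set E, Bornology.IsBounded A → ∀ᶠ r in 𝓝[>] (0 : ℝ), sFun A r ≤ M := by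
  obtain ⟨M, hM, h⟩ := exists_ball_subset_iUnion_ball_pow E
  refine ⟨2 * (Real.log M / Real.log 2), fun A hA => ?_⟩
  obtain ⟨R, hR1, hAR⟩ := hA.subset_ball_lt 1 0
  have hlog2 : 0 < Real.log 2 := Real.log_pos one_lt_two
  filter_upwards [tendsto_log_one_div.eventually_ge_atTop (Real.log R + Real.log 2),
    Ioo_mem_nhdsGT (zero_lt_one (α := ℝ))] with r hr hr01
  have hlogM : 0 ≤ Real.log M := Real.log_natCast_nonneg _
  have hlogR : 0 ≤ Real.log R := Real.log_nonneg hR1.le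
  set k := ⌈Real.log (R / r) / Real.log 2⌉₊ with hk
  have hRr : 1 ≤ R / r := (one_le_div hr01.1).2 (by linarith [hr01.2])
  have hk_lt : (k : ℝ) < Real.log (R / r) / Real.log 2 + 1 :=
    Nat.ceil_lt_add_one (div_nonneg (Real.log_nonneg hRr) hlog2.le)
  have hk_ge : Real.log (R / r) / Real.log 2 ≤ k := Nat.le_ceil _
  have hsmall : R / 2 ^ k ≤ r := by
    rw [div_le_iff₀ hlog2, ← Real.log_pow,
      Real.log_le_log_iff (by positivity [hr01.1]) (by positivity), div_le_iff₀ hr01.1] at hk_ge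
    rw [div_le_iff₀ (by positivity)]
    linarith
  obtain ⟨t, ht, hcov⟩ := h 0 R (by linarith) k
  have hN : _root_.coveringNumber A r ≤ M ^ k := by
    refine (coveringNumber_le_card (t := t) (hAR.trans (hcov.trans ?_))).trans ht
    exact iUnion₂_mono fun y _ => Metric.ball_subset_ball hsmall
  have hlogN : Real.log (_root_.coveringNumber A r) ≤ k * Real.log M := by
    rcases Nat.eq_zero_or_pos (_root_.coveringNumber A r) with h0 | h0
    · rw [h0]
      simpa using mul_nonneg k.cast_nonneg hlogM
    · rw [← Real.log_pow]
      exact Real.log_le_log (by exact_mod_cast h0) (by exact_mod_cast hN)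
  have hsplit : Real.log (R / r) = Real.log R + Real.log (1 / r) := by
    rw [← Real.log_mul (by linarith) (one_div_ne_zero hr01.1.ne'), mul_one_div]
  rw [sFun, div_le_iff₀ (by linarith)]
  have hk2 : (k : ℝ) * Real.log 2 ≤ 2 * Real.log (1 / r) := by
    rw [← sub_lt_iff_lt_add, lt_div_iff₀ hlog2] at hk_lt
    linarith
  calc Real.log (_root_.coveringNumber A r) ≤ k * Real.log M := hlogN
    _ = (Real.log M / Real.log 2) * (k * Real.log 2) := by field_simp
    _ ≤ (Real.log M / Real.log 2) * (2 * Real.log (1 / r)) := by gcongr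
    _ = _ := by ring

end FiniteDimensional

/-- An injective map with conformal strict derivatives is bi-Lipschitz from below on compacts. -/
theorem exists_antilipschitzOn_of_isConformalMap {E : Type*} [NormedAddCommGroup E]
    [NormedSpace ℝ E] {f : E → E} {f' : E → E →L[ℝ] E} {X : Set E}
    (hX : IsCompact X) (hinj : InjOn f X) (hf : ∀ x ∈ X, HasStrictFDerivAt f (f' x) x)
    (hconf : ∀ x ∈ X, IsConformalMap (f' x)) :
    ∃ a : ℝ, 0 < a ∧ ∀ x ∈ X, ∀ y ∈ X, a * dist x y ≤ dist (f x) (f y) := by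
  suffices H : ∃ a : ℝ, 0 < a ∧ ∀ p ∈ X ×ˢ X, a * dist p.1 p.2 ≤ dist (f p.1) (f p.2) by
    obtain ⟨a, ha, h⟩ := H
    exact ⟨a, ha, fun x hx y hy => h (x, y) ⟨hx, hy⟩⟩
  refine (hX.prod hX).induction_on
    (p := fun s => ∃ a : ℝ, 0 < a ∧ ∀ p ∈ s, a * dist p.1 p.2 ≤ dist (f p.1) (f p.2))
    ⟨1, one_pos, by simp⟩ ?_ ?_ ?_
  · rintro s t hst ⟨a, ha, h⟩
    exact ⟨a, ha, fun p hp => h p (hst hp)⟩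
  · rintro s t ⟨a, ha, h⟩ ⟨b, hb, h'⟩
    refine ⟨min a b, lt_min ha hb, fun p hp => ?_⟩
    rcases hp with hp | hp
    · exact (mul_le_mul_of_nonneg_right (min_le_left _ _) dist_nonneg).trans (h p hp)
    · exact (mul_le_mul_of_nonneg_right (min_le_right _ _) dist_nonneg).trans (h' p hp)
  · rintro ⟨x, y⟩ ⟨hx, hy⟩
    rcases eq_or_ne x y with rfl | hxy
    · obtain ⟨c, hc, li, hli⟩ := hconf x hx
      have hc' : 0 < ‖c‖ := norm_pos_iff.2 hc
      refine ⟨_, mem_nhdsWithin_of_mem_nhds ((hf x hx).isLittleO.def (half_pos hc')),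
        ‖c‖ / 2, half_pos hc', ?_⟩
      rintro ⟨u, v⟩ huv
      have huv : ‖f u - f v - f' x (u - v)‖ ≤ ‖c‖ / 2 * ‖u - v‖ := huv
      have hn : ‖f' x (u - v)‖ = ‖c‖ * ‖u - v‖ := by
        rw [hli, smul_apply, norm_smul]
        exact congrArg _ (li.norm_map _)
      rw [dist_eq_norm, dist_eq_norm]
      change ‖c‖ / 2 * ‖u - v‖ ≤ ‖f u - f v‖
      have := norm_sub_norm_le (f' x (u - v)) (f u - f v)
      rw [norm_sub_rev (f' x (u - v))] at this
      linarith
    · have hd : 0 < dist x y := dist_pos.2 hxy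
      have hfd : 0 < dist (f x) (f y) := dist_pos.2 (hinj.ne hx hy hxy)
      set a := dist (f x) (f y) / (2 * dist x y)
      have ha : 0 < a := by positivity
      have hcont : Tendsto (fun p : E × E => dist (f p.1) (f p.2) - a * dist p.1 p.2) (𝓝 (x, y))
          (𝓝 (dist (f x) (f y) - a * dist x y)) := by
        have h1 : ContinuousAt (fun p : E × E => f p.1) (x, y) :=
          ContinuousAt.comp (f := Prod.fst) (hf x hx).continuousAt continuousAt_fst
        have h2 : ContinuousAt (fun p : E × E => f p.2) (x, y) :=
          ContinuousAt.comp (f := Prod.snd) (hf y hy).continuousAt continuousAt_snd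
        exact (h1.dist h2).sub ((continuous_fst.dist continuous_snd).continuousAt.const_mul a)
      have hpos : 0 < dist (f x) (f y) - a * dist x y := by
        have : a * dist x y = dist (f x) (f y) / 2 := by
          simp only [a]
          field_simp
        linarith
      refine ⟨_, mem_nhdsWithin_of_mem_nhds (hcont.eventually_const_lt hpos), a, ha, ?_⟩
      intro p hp
      exact (sub_pos.1 hp).le

namespace CIFS

variable {d : ℕ} (Φ : CIFS d)

/-- `x` is the point of the limit set coded by the sequence `γ`. -/
def IsCodedBy (γ : ℕ → Φ.I) (x : EuclideanSpace ℝ (Fin d)) : Prop :=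
  ∀ n : ℕ, x ∈ compMaps Φ.S (List.ofFn fun k : Fin n => γ k) '' Φ.X

variable {Φ}

theorem mapsTo_compMaps (w : List Φ.I) : MapsTo (compMaps Φ.S w) Φ.X Φ.X := by
  induction w with
  | nil => exact mapsTo_id _
  | cons i w ih => exact (Φ.hSmaps i).comp ih

theorem dist_compMaps_le (w : List Φ.I) {x y : EuclideanSpace ℝ (Fin d)} (hx : x ∈ Φ.X)
    (hy : y ∈ Φ.X) :
    dist (compMaps Φ.S w x) (compMaps Φ.S w y) ≤ Φ.c ^ w.length * dist x y := by
  induction w with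
  | nil => simp [compMaps]
  | cons i w ih =>
    calc dist (compMaps Φ.S (i :: w) x) (compMaps Φ.S (i :: w) y)
        ≤ Φ.c * dist (compMaps Φ.S w x) (compMaps Φ.S w y) :=
          (Φ.hcontr i _ (mapsTo_compMaps w hx) _ (mapsTo_compMaps w hy)).2
      _ ≤ Φ.c * (Φ.c ^ w.length * dist x y) := by gcongr; exact Φ.hc0.le
      _ = _ := by rw [List.length_cons]; ring

theorem continuousOn_compMaps (w : List Φ.I) : ContinuousOn (compMaps Φ.S w) Φ.X := by
  refine LipschitzOnWith.continuousOn (K := (Φ.c ^ w.length).toNNReal) ?_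
  refine LipschitzOnWith.of_dist_le_mul fun x hx y hy => ?_
  rw [Real.coe_toNNReal _ (pow_nonneg Φ.hc0.le _)]
  exact dist_compMaps_le w hx hy

theorem exists_antilipschitzOn_compMaps (w : List Φ.I) :
    ∃ a : ℝ, 0 < a ∧ ∀ x ∈ Φ.X, ∀ y ∈ Φ.X,
      a * dist x y ≤ dist (compMaps Φ.S w x) (compMaps Φ.S w y) := by
  induction w with
  | nil => exact ⟨1, one_pos, by simp [compMaps]⟩
  | cons i w ih =>
    obtain ⟨a, ha, h⟩ := ih
    obtain ⟨b, hb, h'⟩ := exists_antilipschitzOn_of_isConformalMap Φ.hXcompact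
      ((Φ.hTinj i).mono Φ.hXV)
      (fun x hx => ((Φ.hTdiff i).contDiffAt (Φ.hVopen.mem_nhds (Φ.hXV hx))).hasStrictFDerivAt
        one_ne_zero)
      (fun x hx => Φ.hTconf i x (Φ.hXV hx))
    refine ⟨b * a, mul_pos hb ha, fun x hx y hy => ?_⟩
    have hwx := mapsTo_compMaps w hx
    have hwy := mapsTo_compMaps w hy
    have := h' _ hwx _ hwy
    rw [Φ.hTagree i _ hwx, Φ.hTagree i _ hwy] at this
    rw [mul_assoc]
    exact (mul_le_mul_of_nonneg_left (h x hx y hy) hb.le).trans this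

theorem mem_limitSet_iff {x : EuclideanSpace ℝ (Fin d)} :
    x ∈ Φ.limitSet ↔ ∃ γ, Φ.IsCodedBy γ x := by
  simp only [limitSet, mem_iUnion, mem_iInter, IsCodedBy]
  refine exists_congr fun γ => ⟨fun h n => ?_, fun h n => h (n + 1)⟩
  cases n with
  | zero =>
    obtain ⟨y, hy, rfl⟩ := h 0
    exact ⟨_, mapsTo_compMaps (List.ofFn fun k : Fin 1 => γ k) hy, rfl⟩
  | succ n => exact h n

theorem compMaps_append (v w : List Φ.I) :
    compMaps Φ.S (v ++ w) = compMaps Φ.S v ∘ compMaps Φ.S w := by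
  induction v with
  | nil => rfl
  | cons i v ih => simp [compMaps, ih, Function.comp_assoc]

theorem exists_isCodedBy (γ : ℕ → Φ.I) : ∃ x, Φ.IsCodedBy γ x := by
  have h := IsCompact.nonempty_iInter_of_sequence_nonempty_isCompact_isClosed
    (fun n : ℕ => compMaps Φ.S (List.ofFn fun k : Fin n => γ k) '' Φ.X) ?_ ?_ ?_ ?_
  · obtain ⟨x, hx⟩ := h
    exact ⟨x, mem_iInter.1 hx⟩
  · rintro n _ ⟨y, hy, rfl⟩
    refine ⟨compMaps Φ.S [γ n] y, mapsTo_compMaps _ hy, ?_⟩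
    rw [List.ofFn_succ' (n := n), List.concat_eq_append, compMaps_append]
    rfl
  · exact fun n => Φ.hXconn.nonempty.image _
  · exact Φ.hXcompact.image_of_continuousOn (continuousOn_compMaps _)
  · exact fun n => (Φ.hXcompact.image_of_continuousOn (continuousOn_compMaps _)).isClosed

theorem IsCodedBy.mem {γ : ℕ → Φ.I} {x : EuclideanSpace ℝ (Fin d)} (h : Φ.IsCodedBy γ x) :
    x ∈ Φ.X := by
  obtain ⟨y, hy, rfl⟩ := h 0
  exact hy

theorem IsCodedBy.dist_le {γ γ' : ℕ → Φ.I} {x y : EuclideanSpace ℝ (Fin d)}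
    (hx : Φ.IsCodedBy γ x) (hy : Φ.IsCodedBy γ' y) {n : ℕ} (h : ∀ k < n, γ k = γ' k) :
    dist x y ≤ Φ.c ^ n * Metric.diam Φ.X := by
  obtain ⟨u, hu, rfl⟩ := hx n
  obtain ⟨v, hv, rfl⟩ := hy n
  have hw : (fun k : Fin n => γ' k) = fun k : Fin n => γ k := funext fun k => (h k k.2).symm
  rw [hw]
  refine (dist_compMaps_le _ hu hv).trans ?_
  rw [List.length_ofFn]
  exact mul_le_mul_of_nonneg_left (Metric.dist_le_diam_of_mem Φ.hXcompact.isBounded hu hv)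
    (pow_nonneg Φ.hc0.le _)

theorem tendsto_pow_mul_diam :
    Tendsto (fun n : ℕ => Φ.c ^ n * Metric.diam Φ.X) atTop (𝓝 0) := by
  simpa using (tendsto_pow_atTop_nhds_zero_of_lt_one Φ.hc0.le Φ.hc1).mul_const (Metric.diam Φ.X)

theorem IsCodedBy.unique {γ : ℕ → Φ.I} {x y : EuclideanSpace ℝ (Fin d)}
    (hx : Φ.IsCodedBy γ x) (hy : Φ.IsCodedBy γ y) : x = y :=
  dist_le_zero.1 (ge_of_tendsto' tendsto_pow_mul_diam fun _ => hx.dist_le hy fun _ _ => rfl)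

theorem IsCodedBy.cons {γ : ℕ → Φ.I} {x : EuclideanSpace ℝ (Fin d)} (i : Φ.I)
    (h : Φ.IsCodedBy γ x) : Φ.IsCodedBy (Stream'.cons i γ) (Φ.S i x) := by
  intro n
  cases n with
  | zero => exact ⟨_, Φ.hSmaps i h.mem, rfl⟩
  | succ n =>
    obtain ⟨y, hy, hyx⟩ := h n
    refine ⟨y, hy, ?_⟩
    rw [List.ofFn_succ]
    exact congrArg (Φ.S i) hyx

theorem IsCodedBy.exists_concat {γ : ℕ → Φ.I} {x : EuclideanSpace ℝ (Fin d)}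
    (h : Φ.IsCodedBy γ x) (n : ℕ) (γ₀ : ℕ → Φ.I) :
    ∃ γ' : ℕ → Φ.I, (∀ k < n, γ' k = γ₀ k) ∧
      Φ.IsCodedBy γ' (compMaps Φ.S (List.ofFn fun k : Fin n => γ₀ k) x) := by
  induction n generalizing γ₀ with
  | zero => exact ⟨γ, by simp, h⟩
  | succ n ih =>
    obtain ⟨γ', hγ', hx⟩ := ih fun k => γ₀ (k + 1)
    refine ⟨Stream'.cons (γ₀ 0) γ', ?_, ?_⟩
    · rintro (_ | k) hk
      · rfl
      · exact hγ' k (by omega)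
    · rw [List.ofFn_succ]
      exact hx.cons (γ₀ 0)

theorem limitSet_nonempty : Φ.limitSet.Nonempty := by
  have := Φ.hInonempty
  obtain ⟨x, hx⟩ := exists_isCodedBy (fun _ => Classical.arbitrary Φ.I)
  exact ⟨x, mem_limitSet_iff.2 ⟨_, hx⟩⟩

theorem limitSet_subset : Φ.limitSet ⊆ Φ.X := fun _ hx =>
  (mem_limitSet_iff.1 hx).elim fun _ h => h.mem

/-- If countably many sets cover the limit set, the closure of one of them contains an image
of the limit set under a composition of the maps of the system. -/
theorem exists_compMaps_image_limitSet_subset_closure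
    {C : ℕ → Set (EuclideanSpace ℝ (Fin d))} (hC : Φ.limitSet ⊆ ⋃ i, C i) :
    ∃ (i : ℕ) (w : List Φ.I), compMaps Φ.S w '' Φ.limitSet ⊆ closure (C i) := by
  have := Φ.hIcount
  have := Φ.hInonempty
  let : TopologicalSpace Φ.I := ⊥
  have : DiscreteTopology Φ.I := ⟨rfl⟩
  choose π hπ using exists_isCodedBy (Φ := Φ)
  have hcont : Continuous π := by
    refine continuous_iff_continuousAt.2 fun γ => Metric.tendsto_nhds.2 fun ε hε => ?_
    obtain ⟨n, hn⟩ := ((tendsto_pow_mul_diam (Φ := Φ)).eventually_lt_const hε).exists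
    filter_upwards [(PiNat.isOpen_cylinder _ γ n).mem_nhds (PiNat.self_mem_cylinder γ n)]
      with γ' hγ'
    exact ((hπ γ').dist_le (hπ γ) hγ').trans_lt hn
  obtain ⟨i, hi⟩ := nonempty_interior_of_iUnion_of_closed
    (f := fun i => π ⁻¹' closure (C i)) (fun i => isClosed_closure.preimage hcont) (by
      refine eq_univ_of_forall fun γ => ?_
      obtain ⟨i, hi⟩ := mem_iUnion.1 (hC (mem_limitSet_iff.2 ⟨γ, hπ γ⟩))
      exact mem_iUnion.2 ⟨i, subset_closure hi⟩)
  obtain ⟨γ₀, hγ₀⟩ := hi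
  obtain ⟨_, ⟨γ₁, n, rfl⟩, -, hsub⟩ := (PiNat.isTopologicalBasis_cylinders fun _ : ℕ => Φ.I
    ).exists_subset_of_mem_open hγ₀ isOpen_interior
  refine ⟨i, List.ofFn fun k : Fin n => γ₁ k, ?_⟩
  rintro _ ⟨x, hx, rfl⟩
  obtain ⟨γ, hγ⟩ := mem_limitSet_iff.1 hx
  obtain ⟨γ', hγ', hcode⟩ := hγ.exists_concat n γ₁
  rw [hcode.unique (hπ γ')]
  have hmem : γ' ∈ π ⁻¹' closure (C i) := interior_subset (hsub hγ')
  exact hmem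

end CIFS

/-- The modified lower box dimension of the limit set of a CIFS equals its
lower box dimension. -/
theorem dimLMB_eq_dimLB {d : ℕ} (hd : 1 ≤ d) (Phi : CIFS d) :
    dimLMB Phi.limitSet = dimLB Phi.limitSet := by
  obtain ⟨M, hM⟩ := exists_forall_eventually_sFun_le (EuclideanSpace ℝ (Fin d))
  have hmem : dimLB Phi.limitSet ∈
      {s : ℝ | ∃ C : ℕ → Set (EuclideanSpace ℝ (Fin d)), (Phi.limitSet ⊆ ⋃ i, C i) ∧
        (∀ i, (C i).Nonempty ∧ Bornology.IsBounded (C i)) ∧ s = ⨆ i, dimLB (C i)} :=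
    ⟨fun _ => Phi.limitSet, (iUnion_const _).superset,
      fun _ => ⟨CIFS.limitSet_nonempty, Phi.hXcompact.isBounded.subset CIFS.limitSet_subset⟩,
      ciSup_const.symm⟩
  refine le_antisymm (csInf_le ⟨0, ?_⟩ hmem) (le_csInf ⟨_, hmem⟩ ?_)
  · rintro _ ⟨C, -, -, rfl⟩
    exact Real.iSup_nonneg fun i => dimLB_nonneg _
  · rintro _ ⟨C, hcov, hC, rfl⟩
    obtain ⟨i, w, hw⟩ := CIFS.exists_compMaps_image_limitSet_subset_closure hcov
    obtain ⟨a, ha, hanti⟩ := CIFS.exists_antilipschitzOn_compMaps w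
    have hbdd : BddAbove (range fun i => dimLB (C i)) := by
      refine ⟨M, ?_⟩
      rintro _ ⟨j, rfl⟩
      exact liminf_le_of_frequently_le (hM _ (hC j).2).frequently
        ⟨0, Filter.eventually_map.2 (eventually_sFun_nonneg _)⟩
    refine le_trans ?_ (le_ciSup hbdd i)
    exact dimLB_le_of_coveringNumber_le (div_pos four_pos ha) (hM _ (hC i).2) fun r hr =>
      coveringNumber_le_of_antilipschitzOn (hC i).2 ha hr
        (fun x hx y hy => hanti x (CIFS.limitSet_subset hx) y (CIFS.limitSet_subset hy)) hw

end
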